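/- Every Schur polynomial is a Schubert polynomial: let w ∈ S_∞ be a Grassmannian permutation with unique descent at position r (i.e. w(r) > w(r+1) and w(i) < w(i+1) for all i ≠ r), and let λ = (λ_1 ≥ λ_2 ≥ ⋯ ≥ λ_r ≥ 0) be the partition with λ_{r+1−i} = w(i) − i for 1 ≤ i ≤ r. Then 𝔖_w = det[ h_{λ_i + j − i}(x_1, …, x_r) ]_{i,j = 1, …, r}, the Schur polynomial s_λ(x_1, …, x_r). -/

import Mathlib

open MvPolynomial
open scoped Classical

/-- The polynomial ring ℤ[x₁,x₂,…]: the variable with index `i : ℕ` represents `x_{i+1}`. -/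
abbrev PolyRing : Type := MvPolynomial ℕ ℤ

/-- The action of the simple transposition `s_{i+1}` on ℤ[x₁,x₂,…]
(exchanging the variables `x_{i+1}` and `x_{i+2}` and fixing all others). -/
noncomputable def sAct (i : ℕ) (f : PolyRing) : PolyRing :=
  rename (Equiv.swap i (i + 1)) f

/-- The divided difference operator `∂_{i+1}`: the unique polynomial `g` with
`(x_{i+1} - x_{i+2}) * g = f - s_{i+1} f` (it exists, and is unique since the
polynomial ring is a domain). -/
noncomputable def divDiff (i : ℕ) (f : PolyRing) : PolyRing :=
  if h : ∃ g : PolyRing, (X i - X (i + 1)) * g = f - sAct i f then h.choose else 0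

/-- Composite divided difference operator `∂_{a₁} ∘ ∂_{a₂} ∘ ⋯ ∘ ∂_{a_k}` along a word
`a = [a₁, a₂, …, a_k]` (so `∂_{a_k}` is applied first). -/
noncomputable def divDiffWord (a : List ℕ) (f : PolyRing) : PolyRing :=
  a.foldr divDiff f

/-- The length `ℓ(w)` (number of inversions) of a permutation of `{1,2,…}`
(indices shifted down by one, so positions are indexed by `ℕ`). -/
noncomputable def len (w : Equiv.Perm ℕ) : ℕ :=
  Set.ncard {p : ℕ × ℕ | p.1 < p.2 ∧ w p.2 < w p.1}

/-- `a = [a₁, …, a_k]` is a reduced word for `w`: the product of the corresponding simple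
transpositions `s_{a₁} s_{a₂} ⋯ s_{a_k}` is `w` and `k = ℓ(w)`, the number of inversions. -/
def IsReducedWord (w : Equiv.Perm ℕ) (a : List ℕ) : Prop :=
  (a.map fun i => Equiv.swap i (i + 1)).prod = w ∧ a.length = len w

/-- The longest element `w₀` of `S_n` (reversing the first `n` positions, with positions
indexed by `ℕ` starting at `0`). -/
def wZero (n : ℕ) : Equiv.Perm ℕ :=
  Function.Involutive.toPerm (fun i => if i < n then n - 1 - i else i) (by
    intro i
    dsimp only
    split_ifs <;> omega)

/-- The staircase monomial `x₁^{n-1} x₂^{n-2} ⋯ x_{n-1}`, the Schubert polynomial of `w₀`. -/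
noncomputable def staircase (n : ℕ) : PolyRing :=
  ∏ i ∈ Finset.range n, X i ^ (n - 1 - i)

/-- The Schubert polynomial of `w` computed inside `S_n`:
`𝔖_w = ∂_{a₁} ∂_{a₂} ⋯ ∂_{a_k} 𝔖_{w₀}` for a reduced word `w⁻¹ w₀ = s_{a₁} s_{a₂} ⋯ s_{a_k}`
(any choice of reduced word gives the same answer). -/
noncomputable def schubertIn (n : ℕ) (w : Equiv.Perm ℕ) : PolyRing :=
  if h : ∃ a : List ℕ, IsReducedWord (w⁻¹ * wZero n) a then divDiffWord h.choose (staircase n)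
  else 0

/-- The Schubert polynomial `𝔖_w` of a finitely supported permutation `w ∈ S_∞`, computed
inside any `S_n` containing `w` (independent of all choices). -/
noncomputable def schubert (w : Equiv.Perm ℕ) : PolyRing :=
  if h : ∃ n : ℕ, ∀ i, w i ≠ i → i < n then schubertIn h.choose w else 0

/-- The complete homogeneous symmetric polynomial `h_b(x₁, …, x_r)` of degree `b`
(in the variables indexed `0, …, r-1`), inside ℤ[x₁,x₂,…]. -/
noncomputable def completeHomog (r b : ℕ) : PolyRing :=
  ∑ s ∈ Finset.sym (Finset.range r) b, ((s : Multiset ℕ).map X).prod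

/-- `h_b(x₁, …, x_r)` for an integer degree `b`, with `h_b = 0` for `b < 0`. -/
noncomputable def completeHomogZ (r : ℕ) (b : ℤ) : PolyRing :=
  if b < 0 then 0 else completeHomog r b.toNat


theorem sAct_mul (i : ℕ) (f g : PolyRing) : sAct i (f * g) = sAct i f * sAct i g := by
  simp [sAct]

theorem sAct_sub (i : ℕ) (f g : PolyRing) : sAct i (f - g) = sAct i f - sAct i g := by
  simp [sAct]

theorem sAct_add (i : ℕ) (f g : PolyRing) : sAct i (f + g) = sAct i f + sAct i g := by
  simp [sAct]

theorem sAct_X (i j : ℕ) : sAct i (X j) = X (Equiv.swap i (i + 1) j) := by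
  simp [sAct]

theorem sAct_sAct (i : ℕ) (f : PolyRing) : sAct i (sAct i f) = f := by
  unfold sAct
  rw [rename_rename]
  have : (⇑(Equiv.swap i (i + 1)) ∘ ⇑(Equiv.swap i (i + 1))) = id := by
    funext x; simp
  rw [this, rename_id_apply]

theorem X_sub_ne (i j : ℕ) (h : i ≠ j) : (X i - X j : PolyRing) ≠ 0 := by
  intro h'
  exact h (X_injective (sub_eq_zero.mp h'))

theorem divDiff_exists (i : ℕ) (f : PolyRing) :
    ∃ g : PolyRing, (X i - X (i + 1)) * g = f - sAct i f := by
  induction f using MvPolynomial.induction_on with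
  | C a => exact ⟨0, by simp [sAct]⟩
  | add p q hp hq =>
    obtain ⟨a, ha⟩ := hp
    obtain ⟨b, hb⟩ := hq
    exact ⟨a + b, by rw [mul_add, ha, hb, sAct_add]; ring⟩
  | mul_X p j hp =>
    obtain ⟨a, ha⟩ := hp
    rw [sAct_mul, sAct_X]
    by_cases h1 : j = i
    · subst h1
      refine ⟨a * X (j + 1) + p, ?_⟩
      rw [Equiv.swap_apply_left]
      linear_combination X (j + 1) * ha
    by_cases h2 : j = i + 1
    · subst h2
      refine ⟨a * X i - p, ?_⟩
      rw [Equiv.swap_apply_right]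
      linear_combination X i * ha
    · refine ⟨a * X j, ?_⟩
      rw [Equiv.swap_apply_of_ne_of_ne h1 h2]
      linear_combination X j * ha

theorem divDiff_spec (i : ℕ) (f : PolyRing) :
    (X i - X (i + 1)) * divDiff i f = f - sAct i f := by
  have h := divDiff_exists i f
  unfold divDiff
  rw [dif_pos h]
  exact h.choose_spec

theorem divDiff_eq {i : ℕ} {f g : PolyRing} (h : (X i - X (i + 1)) * g = f - sAct i f) :
    divDiff i f = g :=
  mul_left_cancel₀ (X_sub_ne i (i + 1) (by omega)) ((divDiff_spec i f).trans h.symm)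

theorem sAct_comm {i j : ℕ} (h : i + 1 < j) (f : PolyRing) :
    sAct i (sAct j f) = sAct j (sAct i f) := by
  unfold sAct
  rw [rename_rename, rename_rename]
  congr 2
  funext x
  simp only [Function.comp, Equiv.swap_apply_def]
  split_ifs <;> omega

theorem sAct_braid (i : ℕ) (f : PolyRing) :
    sAct i (sAct (i + 1) (sAct i f)) = sAct (i + 1) (sAct i (sAct (i + 1) f)) := by
  unfold sAct
  rw [rename_rename, rename_rename, rename_rename, rename_rename]
  congr 2
  funext x
  simp only [Function.comp, Equiv.swap_apply_def]
  split_ifs <;> omega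

theorem divDiff_comm {i j : ℕ} (h : i + 1 < j) (f : PolyRing) :
    divDiff i (divDiff j f) = divDiff j (divDiff i f) := by
  have hi : (X i - X (i + 1) : PolyRing) ≠ 0 := X_sub_ne _ _ (by omega)
  have hj : (X j - X (j + 1) : PolyRing) ≠ 0 := X_sub_ne _ _ (by omega)
  apply mul_left_cancel₀ (mul_ne_zero hi hj)
  have e1 := divDiff_spec i (divDiff j f)
  have e2 := divDiff_spec j (divDiff i f)
  have e3 := divDiff_spec i f
  have e4 := divDiff_spec j f
  have e5 := congrArg (sAct j) e3
  have e6 := congrArg (sAct i) e4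
  have a1 : Equiv.swap i (i + 1) j = j := Equiv.swap_apply_of_ne_of_ne (by omega) (by omega)
  have a2 : Equiv.swap i (i + 1) (j + 1) = j + 1 :=
    Equiv.swap_apply_of_ne_of_ne (by omega) (by omega)
  have a3 : Equiv.swap j (j + 1) i = i := Equiv.swap_apply_of_ne_of_ne (by omega) (by omega)
  have a4 : Equiv.swap j (j + 1) (i + 1) = i + 1 :=
    Equiv.swap_apply_of_ne_of_ne (by omega) (by omega)
  rw [sAct_mul, sAct_sub, sAct_sub, sAct_X, sAct_X] at e5 e6
  rw [a3, a4] at e5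
  rw [a1, a2] at e6
  have e7 := sAct_comm h f
  linear_combination (X j - X (j + 1)) * e1 + e4 - e6 - (X i - X (i + 1)) * e2 - e3 + e5 + e7

theorem swap_lo (i : ℕ) : Equiv.swap i (i + 1) (i + 1 + 1) = i + 1 + 1 :=
  Equiv.swap_apply_of_ne_of_ne (by omega) (by omega)

theorem swap_hi (i : ℕ) : Equiv.swap (i + 1) (i + 1 + 1) i = i :=
  Equiv.swap_apply_of_ne_of_ne (by omega) (by omega)

theorem divDiff_braid_left (i : ℕ) (f : PolyRing) :
    (X i - X (i + 1)) * (X (i + 1) - X (i + 1 + 1)) * (X i - X (i + 1 + 1)) *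
      divDiff i (divDiff (i + 1) (divDiff i f)) =
    f - sAct i f - sAct (i + 1) f + sAct (i + 1) (sAct i f) + sAct i (sAct (i + 1) f)
      - sAct i (sAct (i + 1) (sAct i f)) := by
  have e1 := divDiff_spec i f
  have e2 := divDiff_spec (i + 1) (divDiff i f)
  have e3 := divDiff_spec i (divDiff (i + 1) (divDiff i f))
  set g1 := divDiff i f
  set g2 := divDiff (i + 1) g1
  set g3 := divDiff i g2
  have e4 := congrArg (sAct i) e2
  have e5 := congrArg (sAct i) e1
  have e6 := congrArg (sAct (i + 1)) e1
  have e7 := congrArg (sAct i) e6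
  simp only [sAct_mul, sAct_sub, sAct_X, sAct_sAct, Equiv.swap_apply_left,
    Equiv.swap_apply_right, swap_lo, swap_hi] at e4 e5 e6 e7
  have e8 : sAct i g1 = g1 := by
    apply mul_left_cancel₀ (X_sub_ne i (i + 1) (by omega))
    linear_combination - e5 - e1
  rw [e8] at e4
  linear_combination (X (i + 1) - X (i + 1 + 1)) * (X i - X (i + 1 + 1)) * e3 +
    (X i - X (i + 1 + 1)) * e2 - (X (i + 1) - X (i + 1 + 1)) * e4 + e1 - e6 + e7

theorem divDiff_braid_right (i : ℕ) (f : PolyRing) :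
    (X i - X (i + 1)) * (X (i + 1) - X (i + 1 + 1)) * (X i - X (i + 1 + 1)) *
      divDiff (i + 1) (divDiff i (divDiff (i + 1) f)) =
    f - sAct i f - sAct (i + 1) f + sAct (i + 1) (sAct i f) + sAct i (sAct (i + 1) f)
      - sAct (i + 1) (sAct i (sAct (i + 1) f)) := by
  have e1 := divDiff_spec (i + 1) f
  have e2 := divDiff_spec i (divDiff (i + 1) f)
  have e3 := divDiff_spec (i + 1) (divDiff i (divDiff (i + 1) f))
  set g1 := divDiff (i + 1) f
  set g2 := divDiff i g1
  set g3 := divDiff (i + 1) g2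
  have e4 := congrArg (sAct (i + 1)) e2
  have e5 := congrArg (sAct (i + 1)) e1
  have e6 := congrArg (sAct i) e1
  have e7 := congrArg (sAct (i + 1)) e6
  simp only [sAct_mul, sAct_sub, sAct_X, sAct_sAct, Equiv.swap_apply_left,
    Equiv.swap_apply_right, swap_lo, swap_hi] at e4 e5 e6 e7
  have e8 : sAct (i + 1) g1 = g1 := by
    apply mul_left_cancel₀ (X_sub_ne (i + 1) (i + 1 + 1) (by omega))
    linear_combination - e5 - e1
  rw [e8] at e4
  linear_combination (X i - X (i + 1)) * (X i - X (i + 1 + 1)) * e3 +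
    (X i - X (i + 1 + 1)) * e2 - (X i - X (i + 1)) * e4 + e1 - e6 + e7

theorem divDiff_braid (i : ℕ) (f : PolyRing) :
    divDiff i (divDiff (i + 1) (divDiff i f)) =
      divDiff (i + 1) (divDiff i (divDiff (i + 1) f)) := by
  have h1 : (X i - X (i + 1) : PolyRing) ≠ 0 := X_sub_ne _ _ (by omega)
  have h2 : (X (i + 1) - X (i + 1 + 1) : PolyRing) ≠ 0 := X_sub_ne _ _ (by omega)
  have h3 : (X i - X (i + 1 + 1) : PolyRing) ≠ 0 := X_sub_ne _ _ (by omega)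
  apply mul_left_cancel₀ (mul_ne_zero (mul_ne_zero h1 h2) h3)
  rw [divDiff_braid_left, divDiff_braid_right, sAct_braid]

/-! ### Lengths and reduced words -/

/-- Inversion set. -/
def invSet (w : Equiv.Perm ℕ) : Set (ℕ × ℕ) := {p : ℕ × ℕ | p.1 < p.2 ∧ w p.2 < w p.1}

theorem len_eq (w : Equiv.Perm ℕ) : len w = (invSet w).ncard := rfl

theorem swap_lt_iff (i a b : ℕ) (h1 : ¬ (a = i ∧ b = i + 1)) (h2 : ¬ (b = i ∧ a = i + 1)) :
    Equiv.swap i (i + 1) a < Equiv.swap i (i + 1) b ↔ a < b := by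
  simp only [Equiv.swap_apply_def]
  split_ifs <;> omega

theorem invSet_swap_mul (i : ℕ) (u : Equiv.Perm ℕ) (h : u⁻¹ i < u⁻¹ (i + 1)) :
    invSet (Equiv.swap i (i + 1) * u) = insert (u⁻¹ i, u⁻¹ (i + 1)) (invSet u) := by
  ext ⟨p, q⟩
  simp only [invSet, Set.mem_ofPred_eq, Set.mem_insert_iff, Prod.mk.injEq, Equiv.Perm.mul_apply]
  have hp : p = u⁻¹ i ↔ u p = i := by rw [Equiv.Perm.eq_inv_iff_eq]
  have hq : q = u⁻¹ (i + 1) ↔ u q = i + 1 := by rw [Equiv.Perm.eq_inv_iff_eq]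
  by_cases c1 : u p = i ∧ u q = i + 1
  · obtain ⟨c1, c2⟩ := c1
    rw [c1, c2, hp.2 c1, hq.2 c2, Equiv.swap_apply_left, Equiv.swap_apply_right]
    simpa using h
  by_cases c2 : u q = i ∧ u p = i + 1
  · obtain ⟨c2, c3⟩ := c2
    have hp' : p = u⁻¹ (i + 1) := by rw [Equiv.Perm.eq_inv_iff_eq]; exact c3
    have hq' : q = u⁻¹ i := by rw [Equiv.Perm.eq_inv_iff_eq]; exact c2
    have : q < p := by rw [hp', hq']; exact h
    constructor
    · rintro ⟨h1, _⟩; omega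
    · rintro (⟨h1, _⟩ | ⟨h1, _⟩)
      · rw [hp, c3] at h1; omega
      · omega
  · rw [swap_lt_iff _ _ _ c2 c1, hp, hq]
    tauto

theorem len_swap_mul (i : ℕ) (u : Equiv.Perm ℕ) (hf : (invSet u).Finite)
    (h : u⁻¹ i < u⁻¹ (i + 1)) : len (Equiv.swap i (i + 1) * u) = len u + 1 := by
  rw [len_eq, len_eq, invSet_swap_mul i u h, Set.ncard_insert_of_notMem _ hf]
  simp [invSet]

theorem swap_swap_mul (i : ℕ) (u : Equiv.Perm ℕ) :
    Equiv.swap i (i + 1) * (Equiv.swap i (i + 1) * u) = u := by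
  rw [← mul_assoc, Equiv.swap_mul_self, one_mul]

theorem inv_swap_mul (i j : ℕ) (u : Equiv.Perm ℕ) :
    (Equiv.swap i (i + 1) * u)⁻¹ j = u⁻¹ (Equiv.swap i (i + 1) j) := by
  simp [mul_inv_rev]

theorem invSet_finite_swap_mul (i : ℕ) (u : Equiv.Perm ℕ) (hf : (invSet u).Finite) :
    (invSet (Equiv.swap i (i + 1) * u)).Finite := by
  rcases lt_trichotomy (u⁻¹ i) (u⁻¹ (i + 1)) with h | h | h
  · rw [invSet_swap_mul i u h]; exact hf.insert _
  · have := u⁻¹.injective h; omega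
  · have h2 := invSet_swap_mul i (Equiv.swap i (i + 1) * u) (by
      rw [inv_swap_mul, inv_swap_mul, Equiv.swap_apply_left, Equiv.swap_apply_right]; exact h)
    rw [swap_swap_mul] at h2
    rw [h2] at hf
    exact hf.subset (Set.subset_insert _ _)

theorem len_swap_mul_desc (i : ℕ) (u : Equiv.Perm ℕ) (hf : (invSet u).Finite)
    (h : u⁻¹ (i + 1) < u⁻¹ i) : len (Equiv.swap i (i + 1) * u) + 1 = len u := by
  have := len_swap_mul i (Equiv.swap i (i + 1) * u) (invSet_finite_swap_mul i u hf) (by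
      rw [inv_swap_mul, inv_swap_mul, Equiv.swap_apply_left, Equiv.swap_apply_right]; exact h)
  rw [swap_swap_mul] at this
  omega

/-- Product of a word. -/
def wordProd (a : List ℕ) : Equiv.Perm ℕ := (a.map fun i => Equiv.swap i (i + 1)).prod

theorem wordProd_cons (i : ℕ) (a : List ℕ) :
    wordProd (i :: a) = Equiv.swap i (i + 1) * wordProd a := by
  simp [wordProd]

theorem invSet_one : invSet 1 = ∅ := by
  ext ⟨p, q⟩
  simp only [invSet, Set.mem_ofPred_eq, Equiv.Perm.one_apply, Set.mem_empty_iff_false, iff_false]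
  omega

theorem len_one : len 1 = 0 := by
  rw [len_eq, invSet_one, Set.ncard_empty]

theorem wordProd_finite (a : List ℕ) : (invSet (wordProd a)).Finite := by
  induction a with
  | nil => 
    have : wordProd [] = 1 := rfl
    rw [this, invSet_one]; exact Set.finite_empty
  | cons i a ih => rw [wordProd_cons]; exact invSet_finite_swap_mul _ _ ih

theorem len_wordProd_le (a : List ℕ) : len (wordProd a) ≤ a.length := by
  induction a with
  | nil => 
    have : wordProd [] = 1 := rfl
    rw [this, len_one]; simp
  | cons i a ih =>
    rw [wordProd_cons, List.length_cons]
    have hf := wordProd_finite a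
    rcases lt_trichotomy ((wordProd a)⁻¹ i) ((wordProd a)⁻¹ (i + 1)) with h | h | h
    · rw [len_swap_mul _ _ hf h]; omega
    · have := (wordProd a)⁻¹.injective h; omega
    · have := len_swap_mul_desc _ _ hf h; omega

theorem perm_eq_one_of_mono (u : Equiv.Perm ℕ) (h : ∀ i, u i < u (i + 1)) : u = 1 := by
  have hm : StrictMono u := strictMono_nat_of_lt_succ h
  have e : (StrictMono.orderIsoOfSurjective u hm u.surjective) = OrderIso.refl ℕ :=
    Subsingleton.elim _ _
  ext x
  have := congrArg (fun f : ℕ ≃o ℕ => f x) e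
  simpa using this

theorem exists_reduced (u : Equiv.Perm ℕ) (hf : (invSet u).Finite) :
    ∃ a, IsReducedWord u a := by
  induction hk : len u using Nat.strong_induction_on generalizing u with
  | _ k ih =>
    by_cases h : ∃ i, u⁻¹ (i + 1) < u⁻¹ i
    · obtain ⟨i, hi⟩ := h
      have h1 := len_swap_mul_desc i u hf hi
      obtain ⟨a, ha1, ha2⟩ := ih _ (by omega) (Equiv.swap i (i + 1) * u)
        (invSet_finite_swap_mul i u hf) rfl
      refine ⟨i :: a, ?_, ?_⟩
      · rw [List.map_cons, List.prod_cons, ha1, swap_swap_mul]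
      · rw [List.length_cons, ha2]; exact h1
    · push Not at h
      have : u⁻¹ = 1 := perm_eq_one_of_mono _ fun i =>
        lt_of_le_of_ne (h i) (fun e => by have := u⁻¹.injective e; omega)
      have : u = 1 := by simpa using this
      subst this
      exact ⟨[], by simp, by rw [len_one]; rfl⟩

theorem reduced_cons (i : ℕ) (u : Equiv.Perm ℕ) (a : List ℕ)
    (hf : (invSet u).Finite) (hi : u⁻¹ (i + 1) < u⁻¹ i)
    (ha : IsReducedWord (Equiv.swap i (i + 1) * u) a) : IsReducedWord u (i :: a) := by
  refine ⟨?_, ?_⟩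
  · rw [List.map_cons, List.prod_cons, ha.1, swap_swap_mul]
  · rw [List.length_cons, ha.2]; exact len_swap_mul_desc i u hf hi

theorem reduced_uncons (i : ℕ) (u : Equiv.Perm ℕ) (a : List ℕ)
    (ha : IsReducedWord u (i :: a)) : (invSet u).Finite ∧ u⁻¹ (i + 1) < u⁻¹ i ∧
      IsReducedWord (Equiv.swap i (i + 1) * u) a := by
  obtain ⟨h1, h2⟩ := ha
  change wordProd (i :: a) = u at h1
  have hf : (invSet u).Finite := h1 ▸ wordProd_finite _
  have hu : Equiv.swap i (i + 1) * u = wordProd a := by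
    rw [← h1, wordProd_cons, swap_swap_mul]
  have hl := len_wordProd_le a
  rw [← hu] at hl
  rw [List.length_cons] at h2
  have hd : u⁻¹ (i + 1) < u⁻¹ i := by
    rcases lt_trichotomy (u⁻¹ i) (u⁻¹ (i + 1)) with h | h | h
    · have := len_swap_mul i u hf h; omega
    · have := u⁻¹.injective h; omega
    · exact h
  refine ⟨hf, hd, hu.symm, ?_⟩
  have := len_swap_mul_desc i u hf hd
  omega

theorem divDiffWord_cons (i : ℕ) (a : List ℕ) (f : PolyRing) :
    divDiffWord (i :: a) f = divDiff i (divDiffWord a f) := rfl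

theorem swap_braid (i : ℕ) (u : Equiv.Perm ℕ) :
    Equiv.swap i (i + 1) * (Equiv.swap (i + 1) (i + 1 + 1) *
        (Equiv.swap i (i + 1) * u)) = Equiv.swap (i + 1) (i + 1 + 1) * (Equiv.swap i (i + 1) *
        (Equiv.swap (i + 1) (i + 1 + 1) * u)) := by
  ext x
  simp only [Equiv.Perm.mul_apply]
  generalize u x = y
  simp only [Equiv.swap_apply_def]
  split_ifs <;> omega

theorem swap_commute (i j : ℕ) (h : i + 1 < j) (u : Equiv.Perm ℕ) :
    Equiv.swap j (j + 1) * (Equiv.swap i (i + 1) * u) =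
        Equiv.swap i (i + 1) * (Equiv.swap j (j + 1) * u) := by
  ext x
  simp only [Equiv.Perm.mul_apply]
  generalize u x = y
  simp only [Equiv.swap_apply_def]
  split_ifs <;> omega

theorem matsumoto_aux (f : PolyRing) (k : ℕ)
    (ih : ∀ (a b : List ℕ) (u : Equiv.Perm ℕ), a.length = k → IsReducedWord u a →
      IsReducedWord u b → divDiffWord a f = divDiffWord b f)
    (i j : ℕ) (hij : i < j) (a b : List ℕ) (u : Equiv.Perm ℕ) (hk : a.length = k)
    (ha : IsReducedWord u (i :: a)) (hb : IsReducedWord u (j :: b)) :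
    divDiffWord (i :: a) f = divDiffWord (j :: b) f := by
  have hkb : b.length = k := by
    have h1 := ha.2
    have h2 := hb.2
    rw [List.length_cons] at h1 h2
    omega
  obtain ⟨hf, hi, ha'⟩ := reduced_uncons i u a ha
  obtain ⟨-, hj, hb'⟩ := reduced_uncons j u b hb
  have fi := invSet_finite_swap_mul i u hf
  have fj := invSet_finite_swap_mul j u hf
  have fij := invSet_finite_swap_mul j _ fi
  have fji := invSet_finite_swap_mul i _ fj
  rw [divDiffWord_cons, divDiffWord_cons]
  by_cases hd : j = i + 1
  · subst hd
    have fiji := invSet_finite_swap_mul i _ fij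
    obtain ⟨c, hc⟩ := exists_reduced _ fiji
    have hbr : Equiv.swap i (i + 1) * (Equiv.swap (i + 1) (i + 1 + 1) *
        (Equiv.swap i (i + 1) * u)) = Equiv.swap (i + 1) (i + 1 + 1) * (Equiv.swap i (i + 1) *
        (Equiv.swap (i + 1) (i + 1 + 1) * u)) := by
      exact swap_braid i u
    have r1 : IsReducedWord (Equiv.swap i (i + 1) * u) ((i + 1) :: i :: c) := by
      apply reduced_cons _ _ _ fi
      · rw [inv_swap_mul, inv_swap_mul, Equiv.swap_apply_right, swap_lo]; omega
      apply reduced_cons _ _ _ fij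
      · rw [inv_swap_mul, inv_swap_mul, inv_swap_mul, inv_swap_mul, Equiv.swap_apply_left,
          swap_hi, swap_lo, Equiv.swap_apply_left]; omega
      exact hc
    rw [hbr] at hc
    have r2 : IsReducedWord (Equiv.swap (i + 1) (i + 1 + 1) * u) (i :: (i + 1) :: c) := by
      apply reduced_cons _ _ _ fj
      · rw [inv_swap_mul, inv_swap_mul, Equiv.swap_apply_left, swap_hi]; omega
      apply reduced_cons _ _ _ fji
      · rw [inv_swap_mul, inv_swap_mul, inv_swap_mul, inv_swap_mul, Equiv.swap_apply_right,
          swap_hi, swap_lo, Equiv.swap_apply_right]; omega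
      exact hc
    rw [ih _ _ _ hk ha' r1, ih _ _ _ hkb hb' r2]
    simp only [divDiffWord_cons]
    exact divDiff_braid _ _
  · have hlt : i + 1 < j := by omega
    obtain ⟨c, hc⟩ := exists_reduced _ fij
    have a1 : Equiv.swap i (i + 1) j = j := Equiv.swap_apply_of_ne_of_ne (by omega) (by omega)
    have a2 : Equiv.swap i (i + 1) (j + 1) = j + 1 :=
      Equiv.swap_apply_of_ne_of_ne (by omega) (by omega)
    have a3 : Equiv.swap j (j + 1) i = i := Equiv.swap_apply_of_ne_of_ne (by omega) (by omega)
    have a4 : Equiv.swap j (j + 1) (i + 1) = i + 1 :=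
      Equiv.swap_apply_of_ne_of_ne (by omega) (by omega)
    have hbr : Equiv.swap j (j + 1) * (Equiv.swap i (i + 1) * u) =
        Equiv.swap i (i + 1) * (Equiv.swap j (j + 1) * u) := by
      exact swap_commute i j hlt u
    have r1 : IsReducedWord (Equiv.swap i (i + 1) * u) (j :: c) := by
      apply reduced_cons _ _ _ fi
      · rw [inv_swap_mul, inv_swap_mul, a1, a2]; omega
      exact hc
    rw [hbr] at hc
    have r2 : IsReducedWord (Equiv.swap j (j + 1) * u) (i :: c) := by
      apply reduced_cons _ _ _ fj
      · rw [inv_swap_mul, inv_swap_mul, a3, a4]; omega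
      exact hc
    rw [ih _ _ _ hk ha' r1, ih _ _ _ hkb hb' r2]
    simp only [divDiffWord_cons]
    exact divDiff_comm hlt _

theorem matsumoto (f : PolyRing) (k : ℕ) : ∀ (a b : List ℕ) (u : Equiv.Perm ℕ), a.length = k →
    IsReducedWord u a → IsReducedWord u b → divDiffWord a f = divDiffWord b f := by
  induction k with
  | zero =>
    intro a b u hk ha hb
    have h1 := ha.2
    have h2 := hb.2
    rw [List.length_eq_zero_iff.mp hk, List.length_eq_zero_iff.mp (by omega : b.length = 0)]
  | succ k ih =>
    intro a b u hk ha hb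
    have h1 := ha.2
    have h2 := hb.2
    match a, b with
    | [], _ => simp at hk
    | _ :: _, [] => simp at h1 h2 ; omega
    | i :: a, j :: b =>
      have hka : a.length = k := by simpa using hk
      have hkb : b.length = k := by rw [List.length_cons] at h1 h2; omega
      rcases lt_trichotomy i j with h | h | h
      · exact matsumoto_aux f k ih i j h a b u hka ha hb
      · subst h
        rw [divDiffWord_cons, divDiffWord_cons,
          ih _ _ _ hka (reduced_uncons i u a ha).2.2 (reduced_uncons i u b hb).2.2]
      · exact (matsumoto_aux f k ih j i h b a u hkb hb ha).symm

/-- `f` is obtained from the staircase along some reduced word for `w⁻¹ w₀`. -/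
def IsSch (n : ℕ) (w : Equiv.Perm ℕ) (f : PolyRing) : Prop :=
  ∃ a, IsReducedWord (w⁻¹ * wZero n) a ∧ divDiffWord a (staircase n) = f

theorem IsSch.schubertIn_eq {n : ℕ} {w : Equiv.Perm ℕ} {f : PolyRing} (h : IsSch n w f) :
    schubertIn n w = f := by
  obtain ⟨a, ha, hf⟩ := h
  have h : ∃ a : List ℕ, IsReducedWord (w⁻¹ * wZero n) a := ⟨a, ha⟩
  unfold schubertIn
  rw [dif_pos h, ← hf]
  exact matsumoto _ _ _ _ _ rfl h.choose_spec ha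

theorem wZero_apply (n i : ℕ) : wZero n i = if i < n then n - 1 - i else i := rfl

theorem wZero_inv (n : ℕ) : (wZero n)⁻¹ = wZero n := rfl

theorem IsSch.step {n : ℕ} {w : Equiv.Perm ℕ} {f : PolyRing} (h : IsSch n w f) (p : ℕ)
    (hp : w p < n) (hd : w (p + 1) < w p) :
    IsSch n (w * Equiv.swap p (p + 1)) (divDiff p f) := by
  obtain ⟨a, ha, hf⟩ := h
  refine ⟨p :: a, ?_, by rw [divDiffWord_cons, hf]⟩
  have e : (w * Equiv.swap p (p + 1))⁻¹ * wZero n =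
      Equiv.swap p (p + 1) * (w⁻¹ * wZero n) := by
    rw [mul_inv_rev, Equiv.swap_inv, mul_assoc]
  rw [e]
  refine ⟨?_, ?_⟩
  · rw [List.map_cons, List.prod_cons, ha.1]
  · rw [List.length_cons, ha.2, len_swap_mul]
    · rw [← ha.1]; exact wordProd_finite a
    · simp only [mul_inv_rev, inv_inv, Equiv.Perm.mul_apply, wZero_inv, wZero_apply]
      split_ifs <;> omega

theorem IsSch.wZero (n : ℕ) : IsSch n (wZero n) (staircase n) := by
  refine ⟨[], ⟨?_, ?_⟩, rfl⟩
  · simp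
  · rw [inv_mul_cancel, len_one]; rfl

/-! ### Dominant permutations -/

/-- Lehmer code. -/
def code (n : ℕ) (w : Equiv.Perm ℕ) (i : ℕ) : ℕ :=
  ((Finset.range n).filter fun j => i < j ∧ w j < w i).card

theorem code_le (n : ℕ) (w : Equiv.Perm ℕ) (i : ℕ) : code n w i ≤ n := by
  unfold code
  exact (Finset.card_filter_le _ _).trans (by simp)

theorem code_asc {n : ℕ} {w : Equiv.Perm ℕ} {i : ℕ} (h : w i < w (i + 1)) :
    code n w i ≤ code n w (i + 1) := by
  apply Finset.card_le_card
  intro j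
  simp only [Finset.mem_filter, Finset.mem_range]
  rintro ⟨h1, h2, h3⟩
  have : j ≠ i + 1 := by rintro rfl; omega
  refine ⟨h1, by omega, by omega⟩

theorem code_desc {n : ℕ} {w : Equiv.Perm ℕ} {i : ℕ} (hi : i + 1 < n) (h : w (i + 1) < w i) :
    code n w (i + 1) < code n w i := by
  apply Finset.card_lt_card
  rw [Finset.ssubset_iff_of_subset]
  · refine ⟨i + 1, ?_, ?_⟩ <;> simp [hi, h]
  · intro j
    simp only [Finset.mem_filter, Finset.mem_range]
    rintro ⟨h1, h2, h3⟩
    refine ⟨h1, by omega, by omega⟩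

theorem code_swap_left {n : ℕ} {w : Equiv.Perm ℕ} {i : ℕ} (hi : i + 1 < n)
    (h : w i < w (i + 1)) :
    code n (w * Equiv.swap i (i + 1)) i = code n w (i + 1) + 1 := by
  unfold code
  rw [← Finset.card_insert_of_notMem (a := i + 1) (by simp)]
  congr 1
  ext j
  simp only [Finset.mem_filter, Finset.mem_range, Finset.mem_insert, Equiv.Perm.mul_apply,
    Equiv.swap_apply_left]
  by_cases h1 : j = i + 1
  · subst h1; simp [hi, h]
  by_cases h2 : j = i
  · subst h2; simp
  rw [Equiv.swap_apply_of_ne_of_ne h2 h1]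
  constructor
  · rintro ⟨a, b, c⟩; exact Or.inr ⟨a, by omega, c⟩
  · rintro (a | ⟨a, b, c⟩)
    · exact absurd a h1
    · exact ⟨a, by omega, c⟩

theorem code_swap_right {n : ℕ} {w : Equiv.Perm ℕ} {i : ℕ}
    (h : w i < w (i + 1)) :
    code n (w * Equiv.swap i (i + 1)) (i + 1) = code n w i := by
  unfold code
  congr 1
  ext j
  simp only [Finset.mem_filter, Finset.mem_range, Equiv.Perm.mul_apply,
    Equiv.swap_apply_right]
  by_cases h1 : j = i + 1
  · subst h1; simp; omega
  by_cases h2 : j = i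
  · subst h2; simp
  rw [Equiv.swap_apply_of_ne_of_ne h2 h1]
  constructor
  · rintro ⟨a, b, c⟩; exact ⟨a, by omega, c⟩
  · rintro ⟨a, b, c⟩; exact ⟨a, by omega, c⟩

theorem code_swap_other {n : ℕ} {w : Equiv.Perm ℕ} {i t : ℕ} (hi : i + 1 < n)
    (h1 : t ≠ i) (h2 : t ≠ i + 1) :
    code n (w * Equiv.swap i (i + 1)) t = code n w t := by
  unfold code
  refine Finset.card_bij (fun j _ => Equiv.swap i (i + 1) j) ?_ ?_ ?_
  · intro j hj
    rw [Finset.mem_filter, Finset.mem_range, Equiv.Perm.mul_apply, Equiv.Perm.mul_apply,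
      Equiv.swap_apply_of_ne_of_ne h1 h2] at hj
    rw [Finset.mem_filter, Finset.mem_range]
    obtain ⟨a, b, c⟩ := hj
    refine ⟨?_, ?_, c⟩
    · rw [Equiv.swap_apply_def]; split_ifs <;> omega
    · rw [Equiv.swap_apply_def]; split_ifs <;> omega
  · intro a _ b _ hab
    exact (Equiv.swap i (i + 1)).injective hab
  · intro j hj
    rw [Finset.mem_filter, Finset.mem_range] at hj
    obtain ⟨a, b, c⟩ := hj
    refine ⟨Equiv.swap i (i + 1) j, ?_, Equiv.swap_apply_self _ _ _⟩
    rw [Finset.mem_filter, Finset.mem_range, Equiv.Perm.mul_apply, Equiv.Perm.mul_apply,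
      Equiv.swap_apply_of_ne_of_ne h1 h2]
    refine ⟨?_, ?_, ?_⟩
    · rw [Equiv.swap_apply_def]; split_ifs <;> omega
    · rw [Equiv.swap_apply_def]; split_ifs <;> omega
    · rw [Equiv.swap_apply_self]; exact c

theorem sAct_prod_pow (n i : ℕ) (hi : i + 1 < n) (c : ℕ → ℕ) (h : c i = c (i + 1)) :
    sAct i (∏ t ∈ Finset.range n, X t ^ c t) = ∏ t ∈ Finset.range n, X t ^ c t := by
  unfold sAct
  rw [map_prod]
  refine Finset.prod_bij (fun j _ => Equiv.swap i (i + 1) j) ?_ ?_ ?_ ?_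
  · intro j hj
    rw [Finset.mem_range] at *
    rw [Equiv.swap_apply_def]; split_ifs <;> omega
  · intro a _ b _ hab
    exact (Equiv.swap i (i + 1)).injective hab
  · intro j hj
    refine ⟨Equiv.swap i (i + 1) j, ?_, Equiv.swap_apply_self _ _ _⟩
    rw [Finset.mem_range] at *
    rw [Equiv.swap_apply_def]; split_ifs <;> omega
  · intro j hj
    rw [map_pow, rename_X]
    congr 1
    by_cases h1 : j = i
    · subst h1; rw [Equiv.swap_apply_left, h]
    by_cases h2 : j = i + 1
    · subst h2; rw [Equiv.swap_apply_right, h]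
    · rw [Equiv.swap_apply_of_ne_of_ne h1 h2]

theorem divDiff_mul_X (i : ℕ) (g : PolyRing) (hg : sAct i g = g) :
    divDiff i (X i * g) = g := by
  apply divDiff_eq
  rw [sAct_mul, hg, sAct_X, Equiv.swap_apply_left]
  ring

theorem perm_lt {n : ℕ} {w : Equiv.Perm ℕ} (hw : ∀ i, n ≤ i → w i = i) {i : ℕ} (hi : i < n) :
    w i < n := by
  by_contra h
  push Not at h
  have := w.injective (hw _ h)
  omega

theorem eq_wZero {n : ℕ} {w : Equiv.Perm ℕ} (hw : ∀ i, n ≤ i → w i = i)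
    (h : ∀ i, i + 1 < n → w (i + 1) < w i) : w = wZero n := by
  have h1 : ∀ i, i < n → w i + i < n := by
    intro i
    induction i with
    | zero => intro hi; exact perm_lt hw hi
    | succ i ih => intro hi; have := ih (by omega); have := h i hi; omega
  have h2 : ∀ k, k < n → k ≤ w (n - 1 - k) := by
    intro k
    induction k with
    | zero => intro _; omega
    | succ k ih =>
      intro hk
      have a := ih (by omega)
      have b := h (n - 1 - (k + 1)) (by omega)
      have e : n - 1 - (k + 1) + 1 = n - 1 - k := by omega
      rw [e] at b
      omega
  ext i
  rw [wZero_apply]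
  split_ifs with hi
  · have a := h1 i hi
    have b := h2 (n - 1 - i) (by omega)
    have e : n - 1 - (n - 1 - i) = i := by omega
    rw [e] at b
    omega
  · exact hw i (by omega)

theorem code_wZero (n i : ℕ) (hi : i < n) : code n (wZero n) i = n - 1 - i := by
  unfold code
  have : ((Finset.range n).filter fun j => i < j ∧ wZero n j < wZero n i) = Finset.Ioo i n := by
    ext j
    rw [Finset.mem_filter, Finset.mem_range, Finset.mem_Ioo, wZero_apply, wZero_apply]
    split_ifs <;> omega
  rw [this, Nat.card_Ioo]
  omega

theorem isSch_dominant (n k : ℕ) : ∀ (w : Equiv.Perm ℕ), (∀ i, n ≤ i → w i = i) →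
    (∀ i, i + 1 < n → code n w (i + 1) ≤ code n w i) →
    n * n = k + ∑ i ∈ Finset.range n, code n w i →
    IsSch n w (∏ i ∈ Finset.range n, X i ^ code n w i) := by
  induction k using Nat.strong_induction_on with
  | _ k ih =>
  intro w hw hc hk
  by_cases hE : ∃ i, i + 1 < n ∧ w i < w (i + 1)
  · set i := Nat.find hE with hidef
    obtain ⟨hi, hasc⟩ := Nat.find_spec hE
    rw [← hidef] at hi hasc
    have hmin : ∀ m, m < i → ¬ (m + 1 < n ∧ w m < w (m + 1)) := fun m hm => Nat.find_min hE hm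
    have hce : code n w i = code n w (i + 1) := le_antisymm (code_asc hasc) (hc i hi)
    set w' := w * Equiv.swap i (i + 1) with hw'
    have hcl : code n w' i = code n w i + 1 := by rw [hw', code_swap_left hi hasc, hce]
    have hcr : code n w' (i + 1) = code n w (i + 1) := by rw [hw', code_swap_right hasc, hce]
    have hco : ∀ t, t ≠ i → code n w' t = code n w t := by
      intro t ht
      by_cases h2 : t = i + 1
      · rw [h2, hcr]
      · exact code_swap_other hi ht h2
    have himem : i ∈ Finset.range n := by rw [Finset.mem_range]; omega
    have hsum : ∑ t ∈ Finset.range n, code n w' t = ∑ t ∈ Finset.range n, code n w t + 1 := by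
      rw [← Finset.add_sum_erase _ _ himem, ← Finset.add_sum_erase _ (code n w) himem, hcl,
        Finset.sum_congr rfl (fun t ht => hco t (Finset.ne_of_mem_erase ht))]
      ring
    have hbound : ∑ t ∈ Finset.range n, code n w' t ≤ n * n := by
      calc _ ≤ ∑ t ∈ Finset.range n, n := Finset.sum_le_sum fun t _ => code_le n w' t
        _ = n * n := by simp
    have hprod : (∏ t ∈ Finset.range n, X t ^ code n w' t : PolyRing) =
        X i * ∏ t ∈ Finset.range n, X t ^ code n w t := by
      rw [← Finset.mul_prod_erase _ _ himem,
        ← Finset.mul_prod_erase _ (fun t => X t ^ code n w t) himem, hcl,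
        Finset.prod_congr rfl (fun t ht => by rw [hco t (Finset.ne_of_mem_erase ht)])]
      ring
    have hfix : ∀ t, n ≤ t → w' t = t := by
      intro t ht
      rw [hw', Equiv.Perm.mul_apply, Equiv.swap_apply_of_ne_of_ne (by omega) (by omega), hw t ht]
    have key := ih (k - 1) (by omega) w' hfix (by
      intro t ht
      by_cases h1 : t = i
      · rw [h1, hcl, hcr]; omega
      by_cases h2 : t + 1 = i
      · have h3 := hmin t (by omega)
        have h4 : w (t + 1) < w t := by
          rcases lt_trichotomy (w t) (w (t + 1)) with h | h | h
          · exact absurd ⟨ht, h⟩ h3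
          · have := w.injective h; omega
          · exact h
        have h5 := code_desc ht h4
        rw [hco t h1, h2, hcl]
        rw [h2] at h5
        omega
      · rw [hco t h1, hco (t + 1) h2]; exact hc t ht) (by omega)
    have wi : w' i = w (i + 1) := by rw [hw']; simp
    have wi1 : w' (i + 1) = w i := by rw [hw']; simp
    have st := key.step i (by rw [wi]; exact perm_lt hw hi) (by rw [wi, wi1]; exact hasc)
    rw [hprod, divDiff_mul_X i _ (sAct_prod_pow n i hi _ hce), hw', mul_assoc,
      Equiv.swap_mul_self, mul_one] at st
    exact st
  · push Not at hE
    have e : w = wZero n := eq_wZero hw fun i hi =>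
      lt_of_le_of_ne (hE i hi) (fun e => by have := w.injective e; omega)
    subst e
    have : (∏ i ∈ Finset.range n, X i ^ code n (wZero n) i : PolyRing) = staircase n := by
      unfold staircase
      refine Finset.prod_congr rfl fun i hi => ?_
      rw [code_wZero n i (Finset.mem_range.mp hi)]
    rw [this]
    exact IsSch.wZero n

/-! ### Complete homogeneous polynomials -/

/-- complete homogeneous polynomial in a finite set of variables. -/
noncomputable def hS (S : Finset ℕ) (b : ℕ) : PolyRing :=
  ∑ s ∈ Finset.sym S b, ((s : Multiset ℕ).map X).prod

theorem hS_zero (S : Finset ℕ) : hS S 0 = 1 := by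
  unfold hS
  simp
  rfl

theorem hS_empty (b : ℕ) : hS ∅ (b + 1) = 0 := by
  unfold hS
  simp

theorem hS_insert (S : Finset ℕ) (a : ℕ) (ha : a ∉ S) (b : ℕ) :
    hS (insert a S) (b + 1) = X a * hS (insert a S) b + hS S (b + 1) := by
  unfold hS
  rw [← Finset.sum_filter_add_sum_filter_not (Finset.sym (insert a S) (b + 1)) (fun s => a ∈ s)]
  congr 1
  · rw [Finset.mul_sum]
    symm
    refine Finset.sum_bij (fun s _ => Sym.cons a s) ?_ ?_ ?_ ?_
    · intro s hs
      rw [Finset.mem_filter, Finset.mem_sym_iff]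
      rw [Finset.mem_sym_iff] at hs
      refine ⟨?_, Sym.mem_cons_self a s⟩
      intro x hx
      rcases Sym.mem_cons.mp hx with h | h
      · rw [h]; exact Finset.mem_insert_self _ _
      · exact hs x h
    · intro s _ t _ h
      exact Sym.cons_inj_right a s t |>.mp h
    · intro s hs
      rw [Finset.mem_filter, Finset.mem_sym_iff] at hs
      refine ⟨s.erase a hs.2, ?_, Sym.cons_erase hs.2⟩
      rw [Finset.mem_sym_iff]
      intro x hx
      refine hs.1 x ?_
      rw [← Sym.cons_erase hs.2]
      exact Sym.mem_cons_of_mem hx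
    · intro s _
      change _ = (Multiset.map X (a ::ₘ (s : Multiset ℕ))).prod
      rw [Multiset.map_cons, Multiset.prod_cons]
  · apply Finset.sum_congr _ (fun _ _ => rfl)
    ext s
    rw [Finset.mem_filter, Finset.mem_sym_iff, Finset.mem_sym_iff]
    constructor
    · rintro ⟨h1, h2⟩ x hx
      rcases Finset.mem_insert.mp (h1 x hx) with h | h
      · rw [h] at hx; exact absurd hx h2
      · exact h
    · intro h
      exact ⟨fun x hx => Finset.mem_insert_of_mem (h x hx), fun hx => ha (h a hx)⟩

theorem rename_hS (σ : Equiv.Perm ℕ) (S : Finset ℕ) (b : ℕ) :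
    rename σ (hS S b) = hS (S.image σ) b := by
  induction S using Finset.induction_on generalizing b with
  | empty =>
    cases b with
    | zero => rw [hS_zero, hS_zero, map_one]
    | succ b => rw [Finset.image_empty, hS_empty, map_zero]
  | insert a S ha ihS =>
    induction b with
    | zero => rw [hS_zero, hS_zero, map_one]
    | succ b ihb =>
      rw [Finset.image_insert, hS_insert S a ha, hS_insert, map_add, map_mul, rename_X, ihb, ihS,
        Finset.image_insert]
      simpa using ha

/-- integer-degree version. -/
noncomputable def hZ (S : Finset ℕ) (b : ℤ) : PolyRing :=
  if b < 0 then 0 else hS S b.toNat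

theorem completeHomogZ_eq (r : ℕ) (b : ℤ) : completeHomogZ r b = hZ (Finset.range r) b := rfl

theorem hZ_neg (S : Finset ℕ) (b : ℤ) (h : b < 0) : hZ S b = 0 := by
  unfold hZ; rw [if_pos h]

theorem hZ_nat (S : Finset ℕ) (b : ℕ) : hZ S b = hS S b := by
  unfold hZ; rw [if_neg (by omega)]; simp

theorem hZ_insert (S : Finset ℕ) (a : ℕ) (ha : a ∉ S) (b : ℤ) :
    hZ (insert a S) b = X a * hZ (insert a S) (b - 1) + hZ S b := by
  rcases lt_trichotomy b 0 with h | h | h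
  · rw [hZ_neg _ _ h, hZ_neg _ _ h, hZ_neg _ _ (by omega)]; ring
  · subst h
    rw [hZ_neg _ (0 - 1) (by omega)]
    have := hZ_nat (insert a S) 0
    have h2 := hZ_nat S 0
    rw [hS_zero] at this h2
    simp only [Nat.cast_zero] at this h2
    rw [this, h2]; ring
  · obtain ⟨m, rfl⟩ : ∃ m : ℕ, b = ((m + 1 : ℕ) : ℤ) := ⟨(b - 1).toNat, by omega⟩
    have : ((m + 1 : ℕ) : ℤ) - 1 = (m : ℕ) := by push_cast; ring
    rw [this, hZ_nat, hZ_nat, hZ_nat, hS_insert S a ha]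

theorem rename_hZ (σ : Equiv.Perm ℕ) (S : Finset ℕ) (b : ℤ) :
    rename σ (hZ S b) = hZ (S.image σ) b := by
  unfold hZ
  split_ifs
  · rw [map_zero]
  · exact rename_hS _ _ _

theorem hZ_empty (b : ℤ) (h : 0 < b) : hZ ∅ b = 0 := by
  obtain ⟨m, rfl⟩ : ∃ m : ℕ, b = ((m + 1 : ℕ) : ℤ) := ⟨(b - 1).toNat, by omega⟩
  rw [hZ_nat, hS_empty]

theorem hZ_singleton (a m : ℕ) : hZ {a} m = X a ^ m := by
  rw [hZ_nat]
  induction m with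
  | zero => rw [hS_zero, pow_zero]
  | succ m ih =>
    have := hS_insert ∅ a (by simp) m
    rw [insert_empty_eq, ih, hS_empty] at this
    rw [this, pow_succ]; ring

theorem sAct_hZ_of_ne (k f : ℕ) (b : ℤ) (h : f ≠ k + 1) :
    sAct k (hZ (Finset.range f) b) = hZ (Finset.range f) b := by
  unfold sAct
  rw [rename_hZ]
  congr 1
  ext x
  rw [Finset.mem_image]
  constructor
  · rintro ⟨y, hy, rfl⟩
    rw [Finset.mem_range] at *
    rw [Equiv.swap_apply_def]; split_ifs <;> omega
  · intro hx
    refine ⟨Equiv.swap k (k + 1) x, ?_, Equiv.swap_apply_self _ _ _⟩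
    rw [Finset.mem_range] at *
    rw [Equiv.swap_apply_def]; split_ifs <;> omega

theorem hZ_diff (k : ℕ) (b : ℤ) :
    (X k - X (k + 1)) * hZ (Finset.range (k + 1 + 1)) (b - 1) =
      hZ (Finset.range (k + 1)) b - sAct k (hZ (Finset.range (k + 1)) b) := by
  have e1 : Finset.range (k + 1 + 1) = insert (k + 1) (Finset.range (k + 1)) :=
    Finset.range_add_one
  set T := (Finset.range (k + 1)).image (Equiv.swap k (k + 1)) with hT
  have hmem : ∀ x, x ∈ T ↔ x < k ∨ x = k + 1 := by
    intro x
    rw [hT, Finset.mem_image]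
    constructor
    · rintro ⟨y, hy, rfl⟩
      rw [Finset.mem_range] at hy
      rw [Equiv.swap_apply_def]; split_ifs <;> omega
    · intro hx
      refine ⟨Equiv.swap k (k + 1) x, ?_, Equiv.swap_apply_self _ _ _⟩
      rw [Finset.mem_range]
      rw [Equiv.swap_apply_def]; split_ifs <;> omega
  have e2 : Finset.range (k + 1 + 1) = insert k T := by
    ext x
    rw [Finset.mem_insert, hmem, Finset.mem_range]
    omega
  have e3 : sAct k (hZ (Finset.range (k + 1)) b) = hZ T b := rename_hZ _ _ _
  have r1 := hZ_insert (Finset.range (k + 1)) (k + 1) (by simp) b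
  have r2 := hZ_insert T k (by rw [hmem]; omega) b
  rw [← e1] at r1
  rw [← e2] at r2
  rw [e3]
  linear_combination r1 - r2

/-- Determinant with flags. -/
noncomputable def flagMat (r : ℕ) (μ : ℕ → ℕ) (φ : Fin r → ℕ) : Matrix (Fin r) (Fin r) PolyRing :=
  Matrix.of fun i j => hZ (Finset.range (φ i)) ((μ i : ℤ) + 1 + (j : ℕ) - (φ i : ℕ))

theorem divDiff_flag (r : ℕ) (μ : ℕ → ℕ) (φ : Fin r → ℕ) (k : ℕ) (i : Fin r)
    (hi : φ i = k + 1) (hne : ∀ t, t ≠ i → φ t ≠ k + 1) :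
    divDiff k (flagMat r μ φ).det = (flagMat r μ (Function.update φ i (k + 1 + 1))).det := by
  apply divDiff_eq
  have hs : sAct k (flagMat r μ φ).det =
      ((flagMat r μ φ).updateRow i (fun j => sAct k (flagMat r μ φ i j))).det := by
    unfold sAct
    rw [AlgHom.map_det]
    congr 1
    ext1 t j
    by_cases ht : t = i
    · subst ht; simp
    · rw [Matrix.updateRow_ne ht]
      exact sAct_hZ_of_ne k (φ t) _ (hne t ht)
  have hu : flagMat r μ (Function.update φ i (k + 1 + 1)) =
      (flagMat r μ φ).updateRow i
        (fun j => hZ (Finset.range (k + 1 + 1)) ((μ i : ℤ) + 1 + (j : ℕ) - (k + 1 : ℕ) - 1)) := by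
    ext1 t j
    by_cases ht : t = i
    · subst ht
      simp only [flagMat, Matrix.of_apply, Function.update_self, Matrix.updateRow_self]
      congr 1; push_cast; ring
    · rw [Matrix.updateRow_ne ht]
      simp only [flagMat, Matrix.of_apply, Function.update_of_ne ht]
  rw [hs, hu, ← Matrix.det_updateRow_smul]
  have h0 : (flagMat r μ φ).det = ((flagMat r μ φ).updateRow i (flagMat r μ φ i)).det := by
    rw [Matrix.updateRow_eq_self]
  rw [h0, eq_sub_iff_add_eq]
  have h1 : (flagMat r μ φ).updateRow i ((flagMat r μ φ).updateRow i (flagMat r μ φ i) i) =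
    (flagMat r μ φ) := by simp
  rw [← Matrix.det_updateRow_add]
  congr 2
  funext j
  have := hZ_diff k ((μ i : ℤ) + 1 + (j : ℕ) - (k + 1 : ℕ))
  simp only [Pi.add_apply, Pi.smul_apply, smul_eq_mul, flagMat, Matrix.of_apply, hi]
  rw [this]
  ring

theorem det_monomial (r : ℕ) : ∀ (a : ℕ) (μ : ℕ → ℕ),
    (Matrix.of fun i j : Fin r =>
      hZ (Finset.Ico a (a + i + 1)) ((μ i : ℤ) + (j : ℕ) - (i : ℕ))).det =
    ∏ i ∈ Finset.range r, X (a + i) ^ μ i := by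
  induction r with
  | zero => intro a μ; simp
  | succ r ih =>
    intro a μ
    set B : Matrix (Fin (r + 1)) (Fin (r + 1)) PolyRing := Matrix.of fun i j =>
      if j = 0 then hZ (Finset.Ico a (a + i + 1)) ((μ i : ℤ) + (j : ℕ) - (i : ℕ))
      else hZ (Finset.Ico (a + 1) (a + i + 1)) ((μ i : ℤ) + (j : ℕ) - (i : ℕ)) with hB
    rw [Matrix.det_eq_of_forall_col_eq_smul_add_pred (B := B) (fun _ => X a)]
    · rw [Matrix.det_succ_row_zero, Fin.sum_univ_succ]
      rw [Finset.sum_eq_zero (s := Finset.univ)]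
      · have hb0 : B 0 0 = X a ^ μ 0 := by
          simp only [hB, Matrix.of_apply, if_true]
          have := hZ_singleton a (μ 0)
          simpa using this
        have hsub : B.submatrix Fin.succ (Fin.succAbove 0) = Matrix.of fun i j : Fin r =>
            hZ (Finset.Ico (a + 1) (a + 1 + i + 1))
              (((fun t => μ (t + 1)) i : ℤ) + (j : ℕ) - (i : ℕ)) := by
          ext1 i j
          simp only [hB, Matrix.submatrix_apply, Matrix.of_apply, Fin.zero_succAbove,
            Fin.succ_ne_zero, if_false, Fin.val_succ]
          congr 1
          · congr 1; ring
          · push_cast; ring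
        rw [hsub, ih (a + 1) (fun t => μ (t + 1)), hb0, Finset.prod_range_succ']
        simp only [Fin.val_zero, pow_zero, one_mul, add_zero]
        rw [mul_comm]
        congr 1
        refine Finset.prod_congr rfl fun t _ => ?_
        congr 2; ring
      · intro j _
        have : B 0 j.succ = 0 := by
          simp only [hB, Matrix.of_apply, Fin.succ_ne_zero, if_false, Fin.val_zero, add_zero,
            Finset.Ico_self]
          apply hZ_empty
          rw [Fin.val_succ]; push_cast; omega
        rw [this]; ring
    · intro i
      simp [hB]
    · intro i j
      simp only [hB, Matrix.of_apply, Fin.succ_ne_zero, if_false]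
      have hI : Finset.Ico a (a + i + 1) = insert a (Finset.Ico (a + 1) (a + i + 1)) := by
        ext x
        simp only [Finset.mem_insert, Finset.mem_Ico]
        omega
      have := hZ_insert (Finset.Ico (a + 1) (a + i + 1)) a (by simp)
        ((μ i : ℤ) + (j.succ : Fin (r + 1)) - (i : ℕ))
      rw [← hI] at this
      rw [this, add_comm]
      congr 3
      rw [Fin.val_succ, Fin.val_castSucc]; push_cast; ring


/-! ### Final sorting phase -/

/-- Positions in the intermediate permutations. -/
def idx (r i p q : ℕ) : ℕ :=
  if q < i then r - 1 - q else if q < p then q - i else if q = p then r - 1 - i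
    else if q < r then q - i - 1 else q

/-- Flags in the intermediate determinants. -/
def flg (r i p : ℕ) (t : Fin r) : ℕ :=
  if (t : ℕ) < i then t + 1 else if (t : ℕ) = i then p + 1 else r

/-- State of the sorting phase. -/
def SortState (n r : ℕ) (w : Equiv.Perm ℕ) (i p : ℕ) : Prop :=
  ∃ u, IsSch n u (flagMat r (fun t => w (r - 1 - t)) (flg r i p)).det ∧ ∀ q, u q = w (idx r i p q)

theorem SortState.step {n r : ℕ} {w : Equiv.Perm ℕ} (hw : ∀ i, n ≤ i → w i = i) (hrn : r < n)
    (hm : ∀ a b, a < b → b < r → w a < w b) {i p : ℕ} (hip : i ≤ p) (hp : p + 1 < r)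
    (h : SortState n r w i p) : SortState n r w i (p + 1) := by
  obtain ⟨u, hu, hq⟩ := h
  have e1 : idx r i p p = r - 1 - i := by
    unfold idx; split_ifs <;> omega
  have e2 : idx r i p (p + 1) = p - i := by
    unfold idx; split_ifs <;> omega
  have st := hu.step p (by rw [hq, e1]; exact perm_lt hw (by omega))
    (by rw [hq, hq, e1, e2]; exact hm _ _ (by omega) (by omega))
  rw [divDiff_flag r _ _ p ⟨i, by omega⟩ (by simp [flg]) (by
    intro t ht
    have ht' : (t : ℕ) ≠ i := fun h => ht (Fin.ext h)
    unfold flg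
    split_ifs <;> omega)] at st
  refine ⟨u * Equiv.swap p (p + 1), ?_, ?_⟩
  · convert st using 3
    funext t
    by_cases ht : t = ⟨i, by omega⟩
    · rw [ht, Function.update_self]; simp [flg]
    · rw [Function.update_of_ne ht]
      have ht' : (t : ℕ) ≠ i := fun h => ht (Fin.ext h)
      unfold flg
      split_ifs <;> omega
  · intro q
    rw [Equiv.Perm.mul_apply, hq]
    congr 1
    unfold idx
    rw [Equiv.swap_apply_def]
    split_ifs <;> omega

theorem SortState.next {n r : ℕ} {w : Equiv.Perm ℕ} {i : ℕ} (hi : i + 1 < r)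
    (h : SortState n r w (i + 1) (r - 1)) : SortState n r w i i := by
  obtain ⟨u, hu, hq⟩ := h
  refine ⟨u, ?_, ?_⟩
  · convert hu using 3
    funext t
    unfold flg
    split_ifs <;> omega
  · intro q
    rw [hq]
    congr 1
    unfold idx
    split_ifs <;> omega

theorem SortState.run {n r : ℕ} {w : Equiv.Perm ℕ} (hw : ∀ i, n ≤ i → w i = i) (hrn : r < n)
    (hm : ∀ a b, a < b → b < r → w a < w b) (i : ℕ) (h : SortState n r w i i) (d : ℕ)
    (hd : i + d < r) : SortState n r w i (i + d) := by
  induction d with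
  | zero => exact h
  | succ d ih => 
    exact SortState.step (p := i + d) hw hrn hm (Nat.le_add_right i d) (by omega) (ih (by omega))

theorem SortState.all {n r : ℕ} {w : Equiv.Perm ℕ} (hw : ∀ i, n ≤ i → w i = i) (hrn : r < n)
    (hm : ∀ a b, a < b → b < r → w a < w b) (h : SortState n r w (r - 1) (r - 1)) (e : ℕ)
    (he : e < r) : SortState n r w (r - 1 - e) (r - 1) := by
  induction e with
  | zero => exact h
  | succ e ih =>
    have h1 := ih (by omega)
    have e1 : r - 1 - e = (r - 1 - (e + 1)) + 1 := by omega
    rw [e1] at h1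
    have h2 := SortState.run hw hrn hm _ (h1.next (by omega)) (e + 1) (by omega)
    have e2 : r - 1 - (e + 1) + (e + 1) = r - 1 := by omega
    rwa [e2] at h2

theorem code_start {n r : ℕ} {w u : Equiv.Perm ℕ} (hw : ∀ i, n ≤ i → w i = i) (hrn : r < n)
    (hm : ∀ a b, a < b → b < r → w a < w b)
    (hu : ∀ q, u q = w (if q < r then r - 1 - q else q)) (i : ℕ) (hi : i < r) :
    code n u i = w (r - 1 - i) := by
  have hui : u i = w (r - 1 - i) := by rw [hu, if_pos hi]
  unfold code
  rw [← Finset.card_image_of_injective _ u.injective, ← hui]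
  have : (((Finset.range n).filter fun j => i < j ∧ u j < u i).image u) =
      Finset.range (u i) := by
    ext v
    rw [Finset.mem_image, Finset.mem_range]
    constructor
    · rintro ⟨j, hj, rfl⟩
      rw [Finset.mem_filter] at hj
      exact hj.2.2
    · intro hv
      obtain ⟨j, rfl⟩ := u.surjective v
      refine ⟨j, ?_, rfl⟩
      rw [Finset.mem_filter, Finset.mem_range]
      refine ⟨?_, ?_, hv⟩
      · by_contra hj
        have h1 : u j = j := by rw [hu, if_neg (by omega), hw j (by omega)]
        have h2 : u i < n := by rw [hui]; exact perm_lt hw (by omega)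
        omega
      · by_contra hj
        have hne : j ≠ i := by rintro rfl; omega
        have h1 : u j = w (r - 1 - j) := by rw [hu, if_pos (by omega)]
        have := hm (r - 1 - i) (r - 1 - j) (by omega) (by omega)
        omega
  rw [this, Finset.card_range]

theorem code_start_zero {n r : ℕ} {w u : Equiv.Perm ℕ}
    (hm : ∀ a b, r ≤ a → a < b → w a < w b)
    (hu : ∀ q, u q = w (if q < r then r - 1 - q else q)) (i : ℕ) (hi : r ≤ i) :
    code n u i = 0 := by
  unfold code
  rw [Finset.card_eq_zero, Finset.filter_eq_empty_iff]
  rintro j - ⟨h1, h2⟩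
  rw [hu, hu, if_neg (by omega), if_neg (by omega)] at h2
  have := hm i j hi h1
  omega

theorem sortState_start {n r : ℕ} {w : Equiv.Perm ℕ} (hw : ∀ i, n ≤ i → w i = i) (hrn : r < n)
    (hr : 1 ≤ r) (hm : ∀ a b, a < b → b < r → w a < w b)
    (hm2 : ∀ a b, r ≤ a → a < b → w a < w b) : SortState n r w (r - 1) (r - 1) := by
  set u := w * wZero r with hudef
  have hu : ∀ q, u q = w (if q < r then r - 1 - q else q) := fun q => rfl
  have c1 := fun i hi => code_start hw hrn hm hu i hi
  have c2 := fun i hi => code_start_zero (n := n) hm2 hu i hi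
  have hbound : ∑ t ∈ Finset.range n, code n u t ≤ n * n := by
    calc _ ≤ ∑ t ∈ Finset.range n, n := Finset.sum_le_sum fun t _ => code_le n u t
      _ = n * n := by simp
  have key := isSch_dominant n (n * n - ∑ t ∈ Finset.range n, code n u t) u (by
      intro i hi
      rw [hu, if_neg (by omega), hw i hi]) (by
      intro i _
      by_cases h1 : i + 1 < r
      · rw [c1 _ h1, c1 _ (by omega)]
        exact (hm _ _ (by omega) (by omega)).le
      · rw [c2 (i + 1) (by omega)]; omega) (by omega)
  refine ⟨u, ?_, ?_⟩
  · convert key using 1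
    have h1 : (∏ i ∈ Finset.range n, X i ^ code n u i : PolyRing) =
        ∏ i ∈ Finset.range r, X (0 + i) ^ (fun t => w (r - 1 - t)) i := by
      symm
      have hsub : Finset.range r ⊆ Finset.range n := by
        intro x; rw [Finset.mem_range, Finset.mem_range]; omega
      rw [← Finset.prod_subset hsub]
      · refine Finset.prod_congr rfl fun i hi => ?_
        rw [zero_add, c1 i (Finset.mem_range.mp hi)]
      · intro i _ hi
        rw [Finset.mem_range] at hi
        rw [c2 i (by omega), pow_zero]
    rw [h1, ← det_monomial r 0]
    congr 1
    ext1 t j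
    have hf : flg r (r - 1) (r - 1) t = t + 1 := by
      unfold flg
      split_ifs <;> omega
    simp only [flagMat, Matrix.of_apply, hf]
    congr 1
    · rw [Finset.range_eq_Ico, zero_add]
    · push_cast; ring
  · intro q
    rw [hu]
    congr 1
    unfold idx
    split_ifs <;> omega

/-- Every Schur polynomial is a Schubert polynomial: let `w ∈ S_∞` be a
Grassmannian permutation with unique descent at position `r` (in our 0-based indexing of
positions, `w(r-1) > w(r)` and `w(i) < w(i+1)` for all `i ≠ r - 1`), and let
`λ = (λ₁ ≥ ⋯ ≥ λ_r ≥ 0)` be the partition with (1-based) `λ_{r+1-i} = w(i) - i` for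
`1 ≤ i ≤ r`, i.e. `λ (j) = w (r-1-j) - (r-1-j)` for `j : Fin r` (0-based).  Then
`𝔖_w = det [ h_{λ_i + j - i}(x₁, …, x_r) ]_{i,j}`, the Schur polynomial `s_λ(x₁, …, x_r)`. -/
theorem schur_is_schubert (w : Equiv.Perm ℕ) (hw : {i : ℕ | w i ≠ i}.Finite)
    (r : ℕ) (hr : 1 ≤ r)
    (hdesc : w r < w (r - 1)) (hasc : ∀ i : ℕ, i ≠ r - 1 → w i < w (i + 1)) :
    schubert w =
      Matrix.det (Matrix.of fun i j : Fin r =>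
        completeHomogZ r
          (((w (r - 1 - (i : ℕ)) - (r - 1 - (i : ℕ)) : ℕ) : ℤ) + (j : ℕ) - (i : ℕ))) := by

  have hm : ∀ a b, a < b → b < r → w a < w b := by
    intro a b hab
    induction b, hab using Nat.le_induction with
    | base => intro h; exact hasc a (by omega)
    | succ b hb ih => intro h; exact (ih (by omega)).trans (hasc b (by omega))
  have hm2 : ∀ a b, r ≤ a → a < b → w a < w b := by
    intro a b ha hab
    induction b, hab using Nat.le_induction with
    | base => exact hasc a (by omega)
    | succ b hb ih => exact ih.trans (hasc b (by omega))
  have hex : ∃ n : ℕ, ∀ i, w i ≠ i → i < n := by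
    obtain ⟨N, hN⟩ := hw.bddAbove
    exact ⟨N + 1, fun i hi => Nat.lt_succ_of_le (hN hi)⟩
  unfold schubert
  rw [dif_pos hex]
  have hn := hex.choose_spec
  set n := hex.choose
  have hfix : ∀ i, n ≤ i → w i = i := by
    intro i hi
    by_contra h
    have := hn i h
    omega
  have hrn : r < n := by
    by_contra h
    have h1 : w r = r := hfix r (by omega)
    have h2 : w (w (r - 1)) = w (r - 1) := hfix _ (by omega)
    have := w.injective h2
    omega
  have hfin := SortState.all hfix hrn hm (sortState_start hfix hrn hr hm hm2) (r - 1) (by omega)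
  rw [Nat.sub_self] at hfin
  obtain ⟨u, hu, hq⟩ := hfin
  have huw : u = w := by
    ext q
    rw [hq]
    congr 1
    unfold idx
    split_ifs <;> omega
  rw [huw] at hu
  rw [hu.schubertIn_eq]
  have hge : ∀ t, t < r → t ≤ w t := by
    intro t
    induction t with
    | zero => intro _; omega
    | succ t ih =>
      intro h
      have := ih (by omega)
      have := hm t (t + 1) (by omega) h
      omega
  congr 1
  ext1 i j
  have hf : flg r 0 (r - 1) i = r := by
    unfold flg
    split_ifs <;> omega
  simp only [flagMat, Matrix.of_apply, hf, completeHomogZ_eq]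
  congr 1
  have := hge (r - 1 - i) (by omega)
  have := i.2
  omega
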